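/- If a graph G admits a proper vertex coloring with at most 4 colors, then G is K₃-WORM colorable and W^-(G) ≤ 2; indeed, if (V₁, V₂, V₃, V₄) is a partition of the vertex set of G into four independent sets, then the 2-coloring assigning one color to V₁ ∪ V₂ and another color to V₃ ∪ V₄ is a K₃-WORM coloring of G. -/

import Mathlib

open SimpleGraph

/-- A K₃-WORM coloring of `G`: every triangle receives exactly two colors. -/
def IsWormColoring {V : Type*} (G : SimpleGraph V) (c : V → ℕ) : Prop :=
  ∀ u v w : V, G.Adj u v → G.Adj u w → G.Adj v w → ({c u, c v, c w} : Finset ℕ).card = 2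

/-- The number of colors used by a coloring of a finite vertex set. -/
def colorsUsed {V : Type*} [Fintype V] (c : V → ℕ) : ℕ := (Finset.univ.image c).card

/-- The K₃-WORM feasible set of `G`: the set of `s` such that `G` has a
K₃-WORM coloring using exactly `s` colors. -/
def wormFeasible {V : Type*} [Fintype V] (G : SimpleGraph V) : Set ℕ :=
  {s | ∃ c : V → ℕ, IsWormColoring G c ∧ colorsUsed c = s}

/-- `G` is triangle-free: it has no three pairwise adjacent vertices. -/
def TriangleFree {V : Type*} (G : SimpleGraph V) : Prop :=
  ∀ u v w : V, G.Adj u v → G.Adj u w → G.Adj v w → False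

/-- The strong product `G ⊠ K₂`, on vertex set `V × Bool`:
`(u,i)` and `(v,j)` are adjacent iff (`u = v` and `i ≠ j`) or `u`,`v` are adjacent in `G`. -/
def strongProdK2 {V : Type*} (G : SimpleGraph V) : SimpleGraph (V × Bool) :=
  SimpleGraph.fromRel (fun p q => (p.1 = q.1 ∧ p.2 ≠ q.2) ∨ G.Adj p.1 q.1)

/-- A coloring with values in `{0, 1}` such that no triangle is monochromatic is a
K₃-WORM coloring. -/
theorem isWormColoring_of_two_colors {V : Type*} {G : SimpleGraph V} {c : V → ℕ}
    (hc : ∀ v, c v = 0 ∨ c v = 1)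
    (hmono : ∀ u v w, G.Adj u v → G.Adj u w → G.Adj v w → c u = c v → c u ≠ c w) :
    IsWormColoring G c := by
  intro u v w huv huw hvw
  have hne := hmono u v w huv huw hvw
  rcases hc u with hu | hu <;> rcases hc v with hv | hv <;> rcases hc w with hw | hw <;>
    simp_all

/-- If four independent sets cover the vertices, coloring the first two by `0` and the
last two by `1` gives a K₃-WORM coloring. -/
theorem isWormColoring_of_independent_cover {V : Type*} {G : SimpleGraph V}
    {V₁ V₂ V₃ V₄ : Set V} (hcover : ∀ v : V, v ∈ V₁ ∪ V₂ ∪ V₃ ∪ V₄)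
    (h₁ : ∀ u ∈ V₁, ∀ v ∈ V₁, ¬ G.Adj u v) (h₂ : ∀ u ∈ V₂, ∀ v ∈ V₂, ¬ G.Adj u v)
    (h₃ : ∀ u ∈ V₃, ∀ v ∈ V₃, ¬ G.Adj u v) (h₄ : ∀ u ∈ V₄, ∀ v ∈ V₄, ¬ G.Adj u v)
    {c : V → ℕ} (hc₀ : ∀ v ∈ V₁ ∪ V₂, c v = 0) (hc₁ : ∀ v ∈ V₃ ∪ V₄, c v = 1) :
    IsWormColoring G c := by
  simp only [Set.mem_union] at hcover hc₀ hc₁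
  refine isWormColoring_of_two_colors (fun v => ?_) fun u v w huv huw hvw => ?_
  · grind
  · have hu := hcover u
    have hv := hcover v
    have hw := hcover w
    grind

/-- The coloring merging the colors `0, 1` and the colors `2, 3` of a proper 4-coloring
is a K₃-WORM coloring. -/
theorem isWormColoring_of_proper_coloring {V : Type*} {G : SimpleGraph V} {φ : V → Fin 4}
    (hφ : ∀ u v : V, G.Adj u v → φ u ≠ φ v) :
    IsWormColoring G fun v => (φ v : ℕ) / 2 := by
  have hindep (i : Fin 4) : ∀ u ∈ φ ⁻¹' {i}, ∀ v ∈ φ ⁻¹' {i}, ¬ G.Adj u v :=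
    fun u hu v hv huv => hφ u v huv (hu.trans hv.symm)
  refine isWormColoring_of_independent_cover ?_ (hindep 0) (hindep 1) (hindep 2) (hindep 3)
    ?_ ?_
  · intro v
    simp only [Set.mem_union, Set.mem_preimage, Set.mem_singleton_iff]
    omega
  · rintro v (hv | hv) <;> simp_all
  · rintro v (hv | hv) <;> simp_all

/-- If `G` admits a proper vertex coloring with at most 4 colors, then `G` is
K₃-WORM colorable and `W⁻(G) ≤ 2`; indeed, if `(V₁, V₂, V₃, V₄)` is a partition of
the vertex set into four independent sets, then any 2-coloring assigning one color
to `V₁ ∪ V₂` and another color to `V₃ ∪ V₄` is a K₃-WORM coloring of `G`. -/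
theorem fourColorable_worm_two_colorable {V : Type*} [Fintype V] (G : SimpleGraph V)
    (h4 : ∃ φ : V → Fin 4, ∀ u v : V, G.Adj u v → φ u ≠ φ v) :
    (∃ c : V → ℕ, IsWormColoring G c) ∧
    (∀ w : ℕ, IsLeast (wormFeasible G) w → w ≤ 2) ∧
    (∀ V₁ V₂ V₃ V₄ : Set V,
      (∀ v : V, v ∈ V₁ ∪ V₂ ∪ V₃ ∪ V₄) →
      (V₁ ∩ V₂ = ∅) → (V₁ ∩ V₃ = ∅) → (V₁ ∩ V₄ = ∅) →
      (V₂ ∩ V₃ = ∅) → (V₂ ∩ V₄ = ∅) → (V₃ ∩ V₄ = ∅) →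
      (∀ u ∈ V₁, ∀ v ∈ V₁, ¬ G.Adj u v) →
      (∀ u ∈ V₂, ∀ v ∈ V₂, ¬ G.Adj u v) →
      (∀ u ∈ V₃, ∀ v ∈ V₃, ¬ G.Adj u v) →
      (∀ u ∈ V₄, ∀ v ∈ V₄, ¬ G.Adj u v) →
      ∀ c : V → ℕ, (∀ v ∈ V₁ ∪ V₂, c v = 0) → (∀ v ∈ V₃ ∪ V₄, c v = 1) →
        IsWormColoring G c) := by
  obtain ⟨φ, hφ⟩ := h4
  have hworm := isWormColoring_of_proper_coloring hφ
  refine ⟨⟨_, hworm⟩, fun w hw => ?_, ?_⟩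
  · refine (hw.2 ⟨_, hworm, rfl⟩).trans ?_
    refine (Finset.card_le_card (t := Finset.range 2) fun k hk => ?_).trans_eq
      (Finset.card_range 2)
    obtain ⟨v, -, rfl⟩ := Finset.mem_image.mp hk
    simp only [Finset.mem_range]
    omega
  · intro V₁ V₂ V₃ V₄ hcover _ _ _ _ _ _ h₁ h₂ h₃ h₄ c hc₀ hc₁
    exact isWormColoring_of_independent_cover hcover h₁ h₂ h₃ h₄ hc₀ hc₁
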